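/- Let n ≥ 0, let θ_1, …, θ_n and φ_1, …, φ_n be real numbers, and let P_0, …, P_n and Q_0, …, Q_n be complex polynomials with deg P_i = deg Q_i = i for all 0 ≤ i ≤ n, satisfying for all 1 ≤ i ≤ n the recurrences P_i(z) = e^{iφ_i}·cos θ_i·z·P_{i−1}(z) + e^{iφ_i}·sin θ_i·Q_{i−1}(z) and Q_i(z) = sin θ_i·z·P_{i−1}(z) − cos θ_i·Q_{i−1}(z). Then for every 0 ≤ i ≤ n, the polynomials P_i and Q_i have no common root: there is no z₀ ∈ ℂ with P_i(z₀) = 0 and Q_i(z₀) = 0. -/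

import Mathlib

open Polynomial

/-- **Lemma B.1.** The polynomial pairs produced by the generalized-QSP recurrence have no
common roots. -/
theorem stmt_7 (n : ℕ) (θ φ : ℕ → ℝ) (P Q : ℕ → Polynomial ℂ)
    (hdeg : ∀ i ≤ n, (P i).degree = (i : ℕ) ∧ (Q i).degree = (i : ℕ))
    (hrecP : ∀ i, 1 ≤ i → i ≤ n →
      P i = C (Complex.exp ((φ i : ℂ) * Complex.I) * (Real.cos (θ i) : ℂ)) * (X * P (i - 1))
          + C (Complex.exp ((φ i : ℂ) * Complex.I) * (Real.sin (θ i) : ℂ)) * Q (i - 1))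
    (hrecQ : ∀ i, 1 ≤ i → i ≤ n →
      Q i = C ((Real.sin (θ i) : ℂ)) * (X * P (i - 1)) - C ((Real.cos (θ i) : ℂ)) * Q (i - 1)) :
    ∀ i ≤ n, ∀ z : ℂ, ¬((P i).eval z = 0 ∧ (Q i).eval z = 0) := by
  have hQ0 : ∀ i ≤ n, (Q i).eval 0 ≠ 0 := by
    intro i
    induction i with
    | zero =>
      intro h h0
      have hd := (hdeg 0 h).2
      have hc : Q 0 = C ((Q 0).coeff 0) := eq_C_of_degree_le_zero (by rw [hd]; simp)
      rw [hc, eval_C] at h0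
      rw [hc, h0] at hd
      simp at hd
    | succ k ih =>
      intro h h0
      have hq := ih (by omega)
      have rQ := hrecQ (k + 1) (by omega) h
      have rP := hrecP (k + 1) (by omega) h
      rw [Nat.add_sub_cancel] at rQ rP
      rw [rQ] at h0
      simp only [eval_sub, eval_mul, eval_C, eval_X, zero_mul, mul_zero, zero_sub,
        neg_eq_zero, mul_eq_zero] at h0
      have hc := h0.resolve_right hq
      rw [hc, mul_zero, C_0, zero_mul, zero_add] at rP
      have h1 := (hdeg (k + 1) h).1
      have h2 := (hdeg k (by omega)).2
      have h3 : (P (k + 1)).degree ≤ (k : ℕ) := by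
        rw [rP, ← h2]
        rw [← smul_eq_C_mul]
        exact degree_smul_le _ _
      rw [h1] at h3
      have h4 : k + 1 ≤ k := by exact_mod_cast h3
      omega
  intro i
  induction i with
  | zero =>
    intro h z hz
    have hd := (hdeg 0 h).2
    have hc : Q 0 = C ((Q 0).coeff 0) := eq_C_of_degree_le_zero (by rw [hd]; simp)
    have h1 := hQ0 0 h
    have h2 := hz.2
    rw [hc, eval_C] at h1 h2
    exact h1 h2
  | succ k ih =>
    intro h z hz
    obtain ⟨hp, hq⟩ := hz
    have rQ := hrecQ (k + 1) (by omega) h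
    have rP := hrecP (k + 1) (by omega) h
    rw [Nat.add_sub_cancel] at rQ rP
    rw [rQ] at hq
    rw [rP] at hp
    simp only [eval_sub, eval_add, eval_mul, eval_C, eval_X] at hp hq
    have he := Complex.exp_ne_zero ((φ (k + 1) : ℂ) * Complex.I)
    have hcs : (Real.cos (θ (k + 1)) : ℂ) ^ 2 + (Real.sin (θ (k + 1)) : ℂ) ^ 2 = 1 := by
      exact_mod_cast Real.cos_sq_add_sin_sq (θ (k + 1))
    generalize (Real.cos (θ (k + 1)) : ℂ) = c at *
    generalize (Real.sin (θ (k + 1)) : ℂ) = s at *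
    generalize Complex.exp ((φ (k + 1) : ℂ) * Complex.I) = e at *
    have hp' : c * (z * (P k).eval z) + s * (Q k).eval z = 0 := by
      apply (mul_eq_zero.mp (?_ : e * _ = 0)).resolve_left he
      linear_combination hp
    have e1 : z * (P k).eval z = 0 := by
      linear_combination c * hp' + s * hq - (z * (P k).eval z) * hcs
    have e2 : (Q k).eval z = 0 := by
      linear_combination s * hp' - c * hq - ((Q k).eval z) * hcs
    rcases mul_eq_zero.mp e1 with hz | hz
    · rw [hz] at e2
      exact hQ0 k (by omega) e2
    · exact ih (by omega) z ⟨hz, e2⟩
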